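/- For every u ∈ BV(ℝ; ℝ) ∩ L¹(ℝ; ℝ) and every measurable essentially bounded h: ℝ → ℝ, one has ∫_ℝ |u(x + h(x)) − u(x)| dx ≤ (max{ess sup_ℝ h, 0} − min{ess inf_ℝ h, 0}) · TV(u). -/

import Mathlib

open MeasureTheory Set
open scoped ENNReal NNReal

/-- Lemma 4.1: for `u ∈ BV ∩ L¹(ℝ;ℝ)` and `h : ℝ → ℝ` measurable and
essentially bounded,
`∫ |u(x + h(x)) - u(x)| dx ≤ (max{ess sup h, 0} - min{ess inf h, 0}) ⋅ TV(u)`. -/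
theorem statement7 (u h : ℝ → ℝ)
    (hu1 : Integrable u volume)
    (hubv : BoundedVariationOn u Set.univ)
    (hm : Measurable h)
    (hb : ∃ C : ℝ, ∀ᵐ x : ℝ ∂volume, |h x| ≤ C) :
    (∫ x : ℝ, |u (x + h x) - u x|)
      ≤ (max (essSup h volume) 0 - min (essInf h volume) 0)
          * (eVariationOn u Set.univ).toReal := by
  obtain ⟨C, hC⟩ := hb
  have hup : ∀ᵐ x : ℝ ∂volume, h x ≤ essSup h volume :=
    ae_le_essSup (Filter.isBoundedUnder_of_eventually_le (a := C)
      (hC.mono fun x hx => (abs_le.1 hx).2))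
  have hlo : ∀ᵐ x : ℝ ∂volume, essInf h volume ≤ h x :=
    ae_essInf_le (Filter.isBoundedUnder_of_eventually_ge (a := -C)
      (hC.mono fun x hx => (abs_le.1 hx).1))
  generalize essSup h volume = S at *
  generalize essInf h volume = I at *
  set b := max S 0 with hbdef
  set a := min I 0 with hadef
  have ha0 : a ≤ 0 := min_le_right _ _
  have hb0 : 0 ≤ b := le_max_right _ _
  set T := (eVariationOn u Set.univ).toReal with hT
  have hT0 : 0 ≤ T := ENNReal.toReal_nonneg
  have hloc : LocallyBoundedVariationOn u univ := hubv.locallyBoundedVariationOn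
  set P := variationOnFromTo u univ 0 with hP
  have hdiff : ∀ x y, P y - P x = variationOnFromTo u univ x y := fun x y => by
    have := variationOnFromTo.add hloc (mem_univ 0) (mem_univ x) (mem_univ y)
    simp only [hP]; linarith
  have hmono : Monotone P := fun x y hxy => by
    have := variationOnFromTo.nonneg_of_le u univ hxy
    have := hdiff x y
    linarith
  have hle : ∀ x y, x ≤ y → P y - P x ≤ T := fun x y hxy => by
    rw [hdiff, variationOnFromTo.eq_of_le _ _ hxy]
    exact ENNReal.toReal_mono hubv (eVariationOn.mono _ (subset_univ _))
  have habs : ∀ x y p q, x ≤ p → p ≤ y → x ≤ q → q ≤ y → |u p - u q| ≤ P y - P x := by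
    intro x y p q h1 h2 h3 h4
    rw [hdiff, variationOnFromTo.eq_of_le _ _ (h1.trans h2), ← Real.dist_eq]
    have : BoundedVariationOn u (univ ∩ Icc x y) := hubv.mono (subset_univ _)
    exact this.dist_le ⟨mem_univ _, h1, h2⟩ ⟨mem_univ _, h3, h4⟩
  by_cases hF : Integrable (fun x => |u (x + h x) - u x|) volume
  swap
  · rw [integral_undef hF]
    exact mul_nonneg (by linarith) hT0
  have hlim := intervalIntegral_tendsto_integral hF
    (Filter.tendsto_neg_atTop_atBot.comp (tendsto_natCast_atTop_atTop (R := ℝ)))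
    (tendsto_natCast_atTop_atTop (R := ℝ))
  refine le_of_tendsto' hlim fun n => ?_
  have hn : (0 : ℝ) ≤ n := n.cast_nonneg
  simp only [Function.comp]
  have ii : ∀ c d, IntervalIntegrable P volume c d := fun c d => hmono.intervalIntegrable
  have iis : ∀ s c d, IntervalIntegrable (fun x => P (x + s)) volume c d := fun s c d =>
    (hmono.comp (fun x y hxy => by simpa using hxy :
      Monotone fun x : ℝ => x + s)).intervalIntegrable
  calc (∫ x in (-(n:ℝ))..n, |u (x + h x) - u x|)
      ≤ ∫ x in (-(n:ℝ))..n, (P (x + b) - P (x + a)) := by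
        refine intervalIntegral.integral_mono_ae (by linarith) hF.intervalIntegrable
          ((iis b _ _).sub (iis a _ _)) ?_
        filter_upwards [hup, hlo] with x h1 h2
        have h3 : h x ≤ b := h1.trans (le_max_left _ _)
        have h4 : a ≤ h x := (min_le_left _ _).trans h2
        exact habs _ _ _ _ (by linarith) (by linarith) (by linarith) (by linarith)
    _ = (∫ x in (n + a)..(n + b), P x) - ∫ x in (-n + a)..(-n + b), P x := by
        rw [intervalIntegral.integral_sub (iis b _ _) (iis a _ _),
          intervalIntegral.integral_comp_add_right (fun x => P x),
          intervalIntegral.integral_comp_add_right (fun x => P x)]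
        have e1 := intervalIntegral.integral_add_adjacent_intervals (ii (-n + a) (n + a)) (ii (n+a) (n + b))
        have e2 := intervalIntegral.integral_add_adjacent_intervals (ii (-n + a) (-n + b)) (ii (-n+b) (n + b))
        linarith
    _ = ∫ x in a..b, (P (x + n) - P (x + -n)) := by
        rw [intervalIntegral.integral_sub (iis _ _ _) (iis _ _ _),
          intervalIntegral.integral_comp_add_right (fun x => P x),
          intervalIntegral.integral_comp_add_right (fun x => P x)]
        simp only [add_comm]
    _ ≤ ∫ x in a..b, T := by
        refine intervalIntegral.integral_mono_on (by linarith) ((iis _ _ _).sub (iis _ _ _))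
          (by simp) fun x _ => hle _ _ (by linarith)
    _ = (b - a) * T := by simp
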